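/- Let H be a quasi-Hopf algebra over a field k with bijective antipode S (inverse S̄) and Drinfeld twist f = f1⊗f2, f⁻¹ = f̄1⊗f̄2. Then the following four equations hold in H⊗H: (1) S(p^R_1)q^L_1 p^R_2(1) ⊗ q^L_2 p^R_2(2) = S(p^L_2)f1 ⊗ S(p^L_1)f2; (2) q^R_2(1) p^L_1 S̄(q^R_1) ⊗ q^R_2(2) p^L_2 = S̄(q^L_2 f̄2) ⊗ S̄(q^L_1 f̄1); (3) q^R_1 p^L_1(1) ⊗ S̄(p^L_2) q^R_2 p^L_1(2) = S̄(f2 p^R_2) ⊗ S̄(f1 p^R_1); (4) q^L_1(1) p^R_1 ⊗ q^L_1(2) p^R_2 S(q^L_2) = f̄1 S(q^R_2) ⊗ f̄2 S(q^R_1). -/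

import Mathlib

open scoped TensorProduct

noncomputable section

/-- A quasi-Hopf algebra over a field `k`, presented together with explicit
(Sweedler-style) finite representations of the comultiplication and of the
associator `φ` and its inverse `φ⁻¹`.  The fields `n, d1, d2` give, for every
`h : H`, a finite family with `Δ h = ∑ i < n h, d1 h i ⊗ d2 h i`; similarly
`P1, P2, P3` (resp. `Q1, Q2, Q3`) are the components of `φ` (resp. `φ⁻¹`). -/
structure QuasiHopf (k H : Type) [Field k] [Ring H] [Algebra k H] where
  comul : H →ₐ[k] H ⊗[k] H
  counit : H →ₐ[k] k
  n : H → ℕ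
  d1 : H → ℕ → H
  d2 : H → ℕ → H
  comul_eq : ∀ h, comul h = ∑ i ∈ Finset.range (n h), d1 h i ⊗ₜ[k] d2 h i
  np : ℕ
  P1 : ℕ → H
  P2 : ℕ → H
  P3 : ℕ → H
  nq : ℕ
  Q1 : ℕ → H
  Q2 : ℕ → H
  Q3 : ℕ → H
  S : H →ₗ[k] H
  Sinv : H →ₗ[k] H
  alpha : H
  beta : H
  S_one : S 1 = 1
  S_mul : ∀ x y : H, S (x * y) = S y * S x
  Sinv_S : ∀ x : H, Sinv (S x) = x
  S_Sinv : ∀ x : H, S (Sinv x) = x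
  phi_phiInv :
    (∑ a ∈ Finset.range np, P1 a ⊗ₜ[k] (P2 a ⊗ₜ[k] P3 a)) *
      (∑ b ∈ Finset.range nq, Q1 b ⊗ₜ[k] (Q2 b ⊗ₜ[k] Q3 b)) = 1
  phiInv_phi :
    (∑ b ∈ Finset.range nq, Q1 b ⊗ₜ[k] (Q2 b ⊗ₜ[k] Q3 b)) *
      (∑ a ∈ Finset.range np, P1 a ⊗ₜ[k] (P2 a ⊗ₜ[k] P3 a)) = 1
  qcoassoc : ∀ h : H,
    ∑ i ∈ Finset.range (n h), d1 h i ⊗ₜ[k] comul (d2 h i) =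
      (∑ a ∈ Finset.range np, P1 a ⊗ₜ[k] (P2 a ⊗ₜ[k] P3 a)) *
        (∑ i ∈ Finset.range (n h), ∑ j ∈ Finset.range (n (d1 h i)),
          d1 (d1 h i) j ⊗ₜ[k] (d2 (d1 h i) j ⊗ₜ[k] d2 h i)) *
        (∑ b ∈ Finset.range nq, Q1 b ⊗ₜ[k] (Q2 b ⊗ₜ[k] Q3 b))
  counit_left : ∀ h : H, ∑ i ∈ Finset.range (n h), counit (d1 h i) • d2 h i = h
  counit_right : ∀ h : H, ∑ i ∈ Finset.range (n h), counit (d2 h i) • d1 h i = h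
  pentagon :
    (∑ a ∈ Finset.range np, P1 a ⊗ₜ[k] (P2 a ⊗ₜ[k] comul (P3 a))) *
      (∑ a ∈ Finset.range np, ∑ i ∈ Finset.range (n (P1 a)),
        d1 (P1 a) i ⊗ₜ[k] (d2 (P1 a) i ⊗ₜ[k] (P2 a ⊗ₜ[k] P3 a))) =
    ((1 : H) ⊗ₜ[k] (∑ a ∈ Finset.range np, P1 a ⊗ₜ[k] (P2 a ⊗ₜ[k] P3 a))) *
      (∑ a ∈ Finset.range np, ∑ i ∈ Finset.range (n (P2 a)),
        P1 a ⊗ₜ[k] (d1 (P2 a) i ⊗ₜ[k] (d2 (P2 a) i ⊗ₜ[k] P3 a))) *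
      (∑ a ∈ Finset.range np, P1 a ⊗ₜ[k] (P2 a ⊗ₜ[k] (P3 a ⊗ₜ[k] (1 : H))))
  counit_mid_phi :
    ∑ a ∈ Finset.range np, counit (P2 a) • (P1 a ⊗ₜ[k] P3 a) = (1 : H) ⊗ₜ[k] (1 : H)
  antipode_alpha : ∀ h : H,
    ∑ i ∈ Finset.range (n h), S (d1 h i) * alpha * d2 h i = counit h • alpha
  antipode_beta : ∀ h : H,
    ∑ i ∈ Finset.range (n h), d1 h i * beta * S (d2 h i) = counit h • beta
  nondeg_1 : ∑ a ∈ Finset.range np, P1 a * beta * S (P2 a) * alpha * P3 a = 1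
  nondeg_2 : ∑ b ∈ Finset.range nq, S (Q1 b) * alpha * Q2 b * beta * S (Q3 b) = 1
  counit_alpha : counit alpha = 1
  counit_beta : counit beta = 1

namespace QuasiHopf

variable {k H : Type} [Field k] [Ring H] [Algebra k H] (q : QuasiHopf k H)

/-- The associator `φ` as an element of `H ⊗ H ⊗ H`. -/
def Phi : H ⊗[k] (H ⊗[k] H) :=
  ∑ a ∈ Finset.range q.np, q.P1 a ⊗ₜ[k] (q.P2 a ⊗ₜ[k] q.P3 a)

/-- `φ⁻¹` as an element of `H ⊗ H ⊗ H`. -/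
def PhiInv : H ⊗[k] (H ⊗[k] H) :=
  ∑ b ∈ Finset.range q.nq, q.Q1 b ⊗ₜ[k] (q.Q2 b ⊗ₜ[k] q.Q3 b)

/-- first components of `p^R = φ̄1 ⊗ φ̄2 β S(φ̄3)` -/
def pR1 (b : ℕ) : H := q.Q1 b

def pR2 (b : ℕ) : H := q.Q2 b * q.beta * q.S (q.Q3 b)

def pRE : H ⊗[k] H := ∑ b ∈ Finset.range q.nq, q.pR1 b ⊗ₜ[k] q.pR2 b

/-- components of `q^R = φ1 ⊗ S̄(α φ3) φ2` -/
def qR1 (a : ℕ) : H := q.P1 a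

def qR2 (a : ℕ) : H := q.Sinv (q.alpha * q.P3 a) * q.P2 a

def qRE : H ⊗[k] H := ∑ a ∈ Finset.range q.np, q.qR1 a ⊗ₜ[k] q.qR2 a

/-- components of `p^L = φ2 S̄(φ1 β) ⊗ φ3` -/
def pL1 (a : ℕ) : H := q.P2 a * q.Sinv (q.P1 a * q.beta)

def pL2 (a : ℕ) : H := q.P3 a

def pLE : H ⊗[k] H := ∑ a ∈ Finset.range q.np, q.pL1 a ⊗ₜ[k] q.pL2 a

/-- components of `q^L = S(φ̄1) α φ̄2 ⊗ φ̄3` -/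
def qL1 (b : ℕ) : H := q.S (q.Q1 b) * q.alpha * q.Q2 b

def qL2 (b : ℕ) : H := q.Q3 b

def qLE : H ⊗[k] H := ∑ b ∈ Finset.range q.nq, q.qL1 b ⊗ₜ[k] q.qL2 b

/-- `𝕒 = S(φ̄1 φ2) α φ̄2 φ3₍₁₎ ⊗ S(φ1) α φ̄3 φ3₍₂₎` -/
def aEl : H ⊗[k] H :=
  ∑ a ∈ Finset.range q.np, ∑ b ∈ Finset.range q.nq, ∑ m ∈ Finset.range (q.n (q.P3 a)),
    (q.S (q.Q1 b * q.P2 a) * q.alpha * q.Q2 b * q.d1 (q.P3 a) m) ⊗ₜ[k]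
      (q.S (q.P1 a) * q.alpha * q.Q3 b * q.d2 (q.P3 a) m)

/-- `𝕓 = φ1₍₁₎ φ̄1 β S(φ3) ⊗ φ1₍₂₎ φ̄2 β S(φ2 φ̄3)` -/
def bEl : H ⊗[k] H :=
  ∑ a ∈ Finset.range q.np, ∑ b ∈ Finset.range q.nq, ∑ m ∈ Finset.range (q.n (q.P1 a)),
    (q.d1 (q.P1 a) m * q.Q1 b * q.beta * q.S (q.P3 a)) ⊗ₜ[k]
      (q.d2 (q.P1 a) m * q.Q2 b * q.beta * q.S (q.P2 a * q.Q3 b))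

/-- `(S ⊗ S)(Δ^cop x) = S(x₍₂₎) ⊗ S(x₍₁₎)` -/
def scop (x : H) : H ⊗[k] H :=
  ∑ m ∈ Finset.range (q.n x), q.S (q.d2 x m) ⊗ₜ[k] q.S (q.d1 x m)

/-- The Drinfeld twist `f = (S⊗S)(Δ^cop(p^R_1)) · 𝕒 · Δ(p^R_2)`. -/
def twist : H ⊗[k] H :=
  ∑ b ∈ Finset.range q.nq, q.scop (q.pR1 b) * q.aEl * q.comul (q.pR2 b)

/-- `f⁻¹ = Δ(q^L_1) · 𝕓 · (S⊗S)(Δ^cop(q^L_2))`. -/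
def twistInv : H ⊗[k] H :=
  ∑ b ∈ Finset.range q.nq, q.comul (q.qL1 b) * q.bEl * q.scop (q.qL2 b)

/-- `x ⊗ y ↦ S y ⊗ S x` -/
def sswap : H ⊗[k] H →ₗ[k] H ⊗[k] H :=
  (TensorProduct.map q.S q.S).comp (TensorProduct.comm k H H).toLinearMap

/-- `x ⊗ y ↦ S̄ y ⊗ S̄ x` -/
def sswapInv : H ⊗[k] H →ₗ[k] H ⊗[k] H :=
  (TensorProduct.map q.Sinv q.Sinv).comp (TensorProduct.comm k H H).toLinearMap

/-- `U^L = f̄1 S(q^R_2) ⊗ f̄2 S(q^R_1)` -/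
def UL : H ⊗[k] H := q.twistInv * q.sswap q.qRE

/-- `V^L = S̄(f2 p^R_2) ⊗ S̄(f1 p^R_1)` -/
def VL : H ⊗[k] H := q.sswapInv (q.twist * q.pRE)

/-- `U^R = S̄(q^L_2 f̄2) ⊗ S̄(q^L_1 f̄1)` -/
def UR : H ⊗[k] H := q.sswapInv (q.qLE * q.twistInv)

/-- `V^R = S(p^L_2) f1 ⊗ S(p^L_1) f2` -/
def VR : H ⊗[k] H := q.sswap q.pLE * q.twist

/-- `h ↦ h ↼ μ = μ(h₍₁₎) h₍₂₎` -/
def lhook (mu : H →ₐ[k] k) : H →ₗ[k] H :=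
  (TensorProduct.lid k H).toLinearMap.comp
    ((TensorProduct.map mu.toLinearMap LinearMap.id).comp q.comul.toLinearMap)

/-- `h ↦ μ ⇀ h = μ(h₍₂₎) h₍₁₎` -/
def rhook (mu : H →ₐ[k] k) : H →ₗ[k] H :=
  (TensorProduct.rid k H).toLinearMap.comp
    ((TensorProduct.map LinearMap.id mu.toLinearMap).comp q.comul.toLinearMap)

/-- `W^L = μ(φ̄1) f̄1 S(q^R_2 φ̄3) ⊗ f̄2 S((q^R_1 ↼ μ) φ̄2)` -/
def WL (mu : H →ₐ[k] k) : H ⊗[k] H :=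
  q.twistInv * q.sswap ((TensorProduct.map (q.lhook mu) LinearMap.id q.qRE) *
    (∑ b ∈ Finset.range q.nq, mu (q.Q1 b) • (q.Q2 b ⊗ₜ[k] q.Q3 b)))

/-- `W^R = μ(φ3) S̄((μ ⇀ q^L_2) φ2 f̄2) ⊗ S̄(q^L_1 φ1 f̄1)` -/
def WR (mu : H →ₐ[k] k) : H ⊗[k] H :=
  q.sswapInv ((TensorProduct.map LinearMap.id (q.rhook mu) q.qLE) *
    (∑ a ∈ Finset.range q.np, mu (q.P3 a) • (q.P1 a ⊗ₜ[k] q.P2 a)) * q.twistInv)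

section Modules

variable {V W X : Type} [AddCommGroup V] [Module k V] [AddCommGroup W] [Module k W]
  [AddCommGroup X] [Module k X]

/-- The tensor-product action `h · (v ⊗ w) = h₍₁₎ v ⊗ h₍₂₎ w`. -/
def tensAct (ρV : H → Module.End k V) (ρW : H → Module.End k W) (h : H) :
    Module.End k (V ⊗[k] W) :=
  ∑ i ∈ Finset.range (q.n h), TensorProduct.map (ρV (q.d1 h i)) (ρW (q.d2 h i))

/-- The action on the left dual: `(h · ξ)(x) = ξ(S(h) x)`. -/
def dualAct (ρX : H → Module.End k X) (h : H) : Module.End k (Module.Dual k X) :=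
  LinearMap.dualMap (ρX (q.S h))

end Modules

end QuasiHopf

/-- `f` intertwines the two given `H`-actions. -/
def IsHLin {k H V W : Type} [Field k] [Ring H] [Algebra k H]
    [AddCommGroup V] [Module k V] [AddCommGroup W] [Module k W]
    (ρV : H → Module.End k V) (ρW : H → Module.End k W) (f : V →ₗ[k] W) : Prop :=
  ∀ (h : H) (v : V), f (ρV h v) = ρW h (f v)

/-- `x ⊗ y ↦ λ(y) • x` -/
def hitR {k H : Type} [Field k] [Ring H] [Algebra k H] (lam : H →ₗ[k] k) :
    H ⊗[k] H →ₗ[k] H :=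
  (TensorProduct.rid k H).toLinearMap.comp (TensorProduct.map LinearMap.id lam)

/-- `x ⊗ y ↦ λ(x) • y` -/
def hitL {k H : Type} [Field k] [Ring H] [Algebra k H] (lam : H →ₗ[k] k) :
    H ⊗[k] H →ₗ[k] H :=
  (TensorProduct.lid k H).toLinearMap.comp (TensorProduct.map lam LinearMap.id)

namespace QuasiHopf

set_option maxSynthPendingDepth 8

open TensorProduct Algebra.TensorProduct

section Tensors

variable {k H M : Type} [Field k] [Ring H] [Algebra k H] [AddCommGroup M] [Module k M]

theorem tensor_induction₃ {P : H ⊗[k] (H ⊗[k] H) → Prop}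
    (pure : ∀ a b c, P (a ⊗ₜ (b ⊗ₜ c))) (add : ∀ x y, P x → P y → P (x + y)) (x) : P x := by
  induction x using TensorProduct.induction_on with
  | zero => simpa using pure 0 0 0
  | add x y hx hy => exact add _ _ hx hy
  | tmul a x =>
    induction x using TensorProduct.induction_on with
    | zero => simpa using pure 0 0 0
    | add x y hx hy => rw [tmul_add]; exact add _ _ hx hy
    | tmul b c => exact pure a b c

theorem tensor_induction₄ {P : H ⊗[k] (H ⊗[k] (H ⊗[k] H)) → Prop}
    (pure : ∀ a b c d, P (a ⊗ₜ (b ⊗ₜ (c ⊗ₜ d)))) (add : ∀ x y, P x → P y → P (x + y)) (x) :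
    P x := by
  induction x using TensorProduct.induction_on with
  | zero => simpa using pure 0 0 0 0
  | add x y hx hy => exact add _ _ hx hy
  | tmul a x =>
    induction x using tensor_induction₃ with
    | pure b c d => exact pure a b c d
    | add x y hx hy => rw [tmul_add]; exact add _ _ hx hy

/-- The linear map on `H ⊗ H` given by a function linear in each variable. -/
def lin₂ (F : H → H → M) (h₁ : ∀ b, IsLinearMap k fun a => F a b := by
      intros; constructor <;> intros <;>
        simp [mul_add, add_mul, tmul_add, add_tmul, ← smul_tmul'])
    (h₂ : ∀ a, IsLinearMap k fun b => F a b := by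
      intros; constructor <;> intros <;>
        simp [mul_add, add_mul, tmul_add, add_tmul, ← smul_tmul']) : H ⊗[k] H →ₗ[k] M :=
  TensorProduct.lift (LinearMap.mk₂ k F (fun _ _ b => (h₁ b).map_add _ _)
    (fun _ _ b => (h₁ b).map_smul _ _) (fun a _ _ => (h₂ a).map_add _ _)
    (fun _ a _ => (h₂ a).map_smul _ _))

@[simp]
theorem lin₂_tmul (F : H → H → M) (h₁ h₂) (a b : H) :
    lin₂ (k := k) F h₁ h₂ (a ⊗ₜ b) = F a b := rfl

/-- The linear map on `H ⊗ H ⊗ H` given by a function linear in each variable. -/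
def lin₃ (F : H → H → H → M)
    (h₁ : ∀ b c, IsLinearMap k fun a => F a b c := by
      intros; constructor <;> intros <;>
        simp [mul_add, add_mul, tmul_add, add_tmul, ← smul_tmul'])
    (h₂ : ∀ a c, IsLinearMap k fun b => F a b c := by
      intros; constructor <;> intros <;>
        simp [mul_add, add_mul, tmul_add, add_tmul, ← smul_tmul'])
    (h₃ : ∀ a b, IsLinearMap k fun c => F a b c := by
      intros; constructor <;> intros <;>
        simp [mul_add, add_mul, tmul_add, add_tmul, ← smul_tmul']) :
    H ⊗[k] (H ⊗[k] H) →ₗ[k] M :=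
  TensorProduct.lift (LinearMap.mk₂ k
    (fun a x => lin₂ (F a) (fun c => h₂ a c) (fun b => h₃ a b) x)
    (fun a a' x => by
      induction x using TensorProduct.induction_on with
      | zero => simp
      | tmul b c => exact (h₁ b c).map_add _ _
      | add x y hx hy => simp only [map_add, hx, hy]; abel)
    (fun r a x => by
      induction x using TensorProduct.induction_on with
      | zero => simp
      | tmul b c => exact (h₁ b c).map_smul _ _
      | add x y hx hy => simp only [map_add, hx, hy, smul_add])
    (fun a x y => map_add _ _ _) (fun r a x => map_smul _ _ _))

@[simp]
theorem lin₃_tmul (F : H → H → H → M) (h₁ h₂ h₃) (a b c : H) :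
    lin₃ (k := k) F h₁ h₂ h₃ (a ⊗ₜ (b ⊗ₜ c)) = F a b c := rfl

/-- The linear map on `H ⊗ H ⊗ H ⊗ H` given by a function linear in each variable. -/
def lin₄ (F : H → H → H → H → M)
    (h₁ : ∀ b c d, IsLinearMap k fun a => F a b c d := by
      intros; constructor <;> intros <;>
        simp [mul_add, add_mul, tmul_add, add_tmul, ← smul_tmul'])
    (h₂ : ∀ a c d, IsLinearMap k fun b => F a b c d := by
      intros; constructor <;> intros <;>
        simp [mul_add, add_mul, tmul_add, add_tmul, ← smul_tmul'])
    (h₃ : ∀ a b d, IsLinearMap k fun c => F a b c d := by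
      intros; constructor <;> intros <;>
        simp [mul_add, add_mul, tmul_add, add_tmul, ← smul_tmul'])
    (h₄ : ∀ a b c, IsLinearMap k fun d => F a b c d := by
      intros; constructor <;> intros <;>
        simp [mul_add, add_mul, tmul_add, add_tmul, ← smul_tmul']) :
    H ⊗[k] (H ⊗[k] (H ⊗[k] H)) →ₗ[k] M :=
  TensorProduct.lift (LinearMap.mk₂ k
    (fun a x => lin₃ (F a) (fun c d => h₂ a c d) (fun b d => h₃ a b d) (fun b c => h₄ a b c) x)
    (fun a a' x => by
      induction x using tensor_induction₃ with
      | pure b c d => exact (h₁ b c d).map_add _ _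
      | add x y hx hy => simp only [map_add, hx, hy]; abel)
    (fun r a x => by
      induction x using tensor_induction₃ with
      | pure b c d => exact (h₁ b c d).map_smul _ _
      | add x y hx hy => simp only [map_add, hx, hy, smul_add])
    (fun a x y => map_add _ _ _) (fun r a x => map_smul _ _ _))

@[simp]
theorem lin₄_tmul (F : H → H → H → H → M) (h₁ h₂ h₃ h₄) (a b c d : H) :
    lin₄ (k := k) F h₁ h₂ h₃ h₄ (a ⊗ₜ (b ⊗ₜ (c ⊗ₜ d))) = F a b c d := rfl

end Tensors

variable {k H : Type} [Field k] [Ring H] [Algebra k H] (q : QuasiHopf k H)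

/-- `Δ ⊗ id ⊗ id` -/
def D1 : H ⊗[k] (H ⊗[k] H) →ₐ[k] H ⊗[k] (H ⊗[k] (H ⊗[k] H)) :=
  (Algebra.TensorProduct.assoc k k k H H (H ⊗[k] H)).toAlgHom.comp
    (Algebra.TensorProduct.map q.comul (AlgHom.id k (H ⊗[k] H)))

/-- `id ⊗ Δ ⊗ id` -/
def D2 : H ⊗[k] (H ⊗[k] H) →ₐ[k] H ⊗[k] (H ⊗[k] (H ⊗[k] H)) :=
  Algebra.TensorProduct.map (AlgHom.id k H)
    ((Algebra.TensorProduct.assoc k k k H H H).toAlgHom.comp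
      (Algebra.TensorProduct.map q.comul (AlgHom.id k H)))

/-- `id ⊗ id ⊗ Δ` -/
def D3 : H ⊗[k] (H ⊗[k] H) →ₐ[k] H ⊗[k] (H ⊗[k] (H ⊗[k] H)) :=
  Algebra.TensorProduct.map (AlgHom.id k H) (Algebra.TensorProduct.map (AlgHom.id k H) q.comul)

/-- `x ↦ 1 ⊗ x` -/
def I1 : H ⊗[k] (H ⊗[k] H) →ₐ[k] H ⊗[k] (H ⊗[k] (H ⊗[k] H)) :=
  Algebra.TensorProduct.includeRight

/-- `x ↦ x ⊗ 1` -/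
def I4 : H ⊗[k] (H ⊗[k] H) →ₐ[k] H ⊗[k] (H ⊗[k] (H ⊗[k] H)) :=
  Algebra.TensorProduct.map (AlgHom.id k H)
    (Algebra.TensorProduct.map (AlgHom.id k H) Algebra.TensorProduct.includeLeft)

theorem D1_tmul (a b c : H) : q.D1 (a ⊗ₜ (b ⊗ₜ c)) =
    ∑ i ∈ Finset.range (q.n a), q.d1 a i ⊗ₜ (q.d2 a i ⊗ₜ (b ⊗ₜ c)) := by
  simp [D1, q.comul_eq a, sum_tmul]

theorem D2_tmul (a b c : H) : q.D2 (a ⊗ₜ (b ⊗ₜ c)) =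
    ∑ i ∈ Finset.range (q.n b), a ⊗ₜ (q.d1 b i ⊗ₜ (q.d2 b i ⊗ₜ c)) := by
  simp [D2, q.comul_eq b, sum_tmul, tmul_sum]

theorem D3_tmul (a b c : H) : q.D3 (a ⊗ₜ (b ⊗ₜ c)) =
    ∑ i ∈ Finset.range (q.n c), a ⊗ₜ (b ⊗ₜ (q.d1 c i ⊗ₜ q.d2 c i)) := by
  simp [D3, q.comul_eq c, tmul_sum]

theorem I1_apply (x : H ⊗[k] (H ⊗[k] H)) : I1 x = (1 : H) ⊗ₜ x := rfl

theorem I4_tmul (a b c : H) : I4 (a ⊗ₜ[k] (b ⊗ₜ[k] c)) = a ⊗ₜ (b ⊗ₜ (c ⊗ₜ 1)) := rfl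

theorem Phi_mul_PhiInv : q.Phi * q.PhiInv = 1 := q.phi_phiInv

theorem PhiInv_mul_Phi : q.PhiInv * q.Phi = 1 := q.phiInv_phi

theorem map_Phi_mul {A : Type*} [Ring A] [Algebra k A] (j : H ⊗[k] (H ⊗[k] H) →ₐ[k] A) :
    j q.Phi * j q.PhiInv = 1 := by rw [← map_mul, Phi_mul_PhiInv, map_one]

theorem map_PhiInv_mul {A : Type*} [Ring A] [Algebra k A] (j : H ⊗[k] (H ⊗[k] H) →ₐ[k] A) :
    j q.PhiInv * j q.Phi = 1 := by rw [← map_mul, PhiInv_mul_Phi, map_one]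

theorem pentagon_Phi : q.D3 q.Phi * q.D1 q.Phi = I1 q.Phi * q.D2 q.Phi * I4 q.Phi := by
  have h := q.pentagon
  simp only [Phi, map_sum, D1_tmul, D2_tmul, I4_tmul, I1_apply, tmul_sum] at h ⊢
  convert h using 2
  refine Finset.sum_congr rfl fun a _ => ?_
  rw [D3_tmul, q.comul_eq, tmul_sum, tmul_sum]

theorem pentagon_PhiInv :
    q.D1 q.PhiInv * q.D3 q.PhiInv = I4 q.PhiInv * q.D2 q.PhiInv * I1 q.PhiInv := by
  refine left_inv_eq_right_inv (a := q.D3 q.Phi * q.D1 q.Phi) ?_ ?_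
  · rw [mul_assoc, ← mul_assoc (q.D3 q.PhiInv), map_PhiInv_mul, one_mul, map_PhiInv_mul]
  · rw [pentagon_Phi, mul_assoc (I4 q.PhiInv), ← mul_assoc, mul_assoc _ (I4 q.Phi), map_Phi_mul,
      mul_one, mul_assoc, ← mul_assoc (q.D2 q.Phi), map_Phi_mul, one_mul, map_Phi_mul]

theorem I4_mul_D1 : I4 q.Phi * q.D1 q.PhiInv =
    q.D2 q.PhiInv * I1 q.PhiInv * q.D3 q.Phi := by
  have h := congr(I4 q.Phi * $(q.pentagon_PhiInv) * q.D3 q.Phi)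
  rwa [mul_assoc, mul_assoc (q.D1 _), map_PhiInv_mul, mul_one, mul_assoc (I4 q.PhiInv),
    ← mul_assoc (I4 q.Phi), map_Phi_mul, one_mul] at h

theorem I4_mul_D1_mul_D3 : I4 q.Phi * q.D1 q.PhiInv * q.D3 q.PhiInv =
    q.D2 q.PhiInv * I1 q.PhiInv := by
  rw [I4_mul_D1, mul_assoc, map_Phi_mul, mul_one]

theorem I1_mul_D3 : I1 q.PhiInv * q.D3 q.Phi =
    q.D2 q.Phi * I4 q.Phi * q.D1 q.PhiInv := by
  rw [mul_assoc, I4_mul_D1, ← mul_assoc, ← mul_assoc, map_Phi_mul, one_mul]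

theorem I4_PhiInv : I4 q.PhiInv =
    q.D1 q.PhiInv * q.D3 q.PhiInv * (I1 q.Phi * q.D2 q.Phi) := by
  rw [pentagon_PhiInv, mul_assoc, ← mul_assoc (I1 q.PhiInv), map_PhiInv_mul, one_mul, mul_assoc,
    map_PhiInv_mul, mul_one]

/-- `ε ⊗ id` -/
def epsL (A : Type) [Ring A] [Algebra k A] : H ⊗[k] A →ₐ[k] A :=
  (Algebra.TensorProduct.lid k A).toAlgHom.comp
    (Algebra.TensorProduct.map q.counit (AlgHom.id k A))

/-- `id ⊗ ε` -/
def epsR : H ⊗[k] H →ₐ[k] H :=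
  (Algebra.TensorProduct.rid k k H).toAlgHom.comp
    (Algebra.TensorProduct.map (AlgHom.id k H) q.counit)

@[simp]
theorem epsL_tmul (A : Type) [Ring A] [Algebra k A] (a : H) (b : A) :
    q.epsL A (a ⊗ₜ b) = q.counit a • b := by simp [epsL]

@[simp]
theorem epsR_tmul (a b : H) : q.epsR (a ⊗ₜ b) = q.counit b • a := by simp [epsR]

/-- `ε ⊗ id ⊗ id` -/
def e1 : H ⊗[k] (H ⊗[k] H) →ₐ[k] H ⊗[k] H := q.epsL _

/-- `id ⊗ ε ⊗ id` -/
def e2 : H ⊗[k] (H ⊗[k] H) →ₐ[k] H ⊗[k] H :=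
  Algebra.TensorProduct.map (AlgHom.id k H) (q.epsL H)

/-- `id ⊗ id ⊗ ε` -/
def e3 : H ⊗[k] (H ⊗[k] H) →ₐ[k] H ⊗[k] H :=
  Algebra.TensorProduct.map (AlgHom.id k H) q.epsR

@[simp]
theorem e1_tmul (a b c : H) : q.e1 (a ⊗ₜ (b ⊗ₜ c)) = q.counit a • b ⊗ₜ c := by simp [e1]

@[simp]
theorem e2_tmul (a b c : H) : q.e2 (a ⊗ₜ (b ⊗ₜ c)) = q.counit b • a ⊗ₜ c := by simp [e2]

@[simp]
theorem e3_tmul (a b c : H) : q.e3 (a ⊗ₜ (b ⊗ₜ c)) = q.counit c • a ⊗ₜ b := by simp [e3]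

theorem e2_Phi : q.e2 q.Phi = 1 := by
  simpa [Phi, Algebra.TensorProduct.one_def] using q.counit_mid_phi

theorem e2_PhiInv : q.e2 q.PhiInv = 1 := by
  simpa [e2_Phi] using q.map_Phi_mul q.e2

theorem epsL_comul (h : H) : q.epsL H (q.comul h) = h := by
  simpa [q.comul_eq h] using q.counit_left h

theorem epsR_comul (h : H) : q.epsR (q.comul h) = h := by
  simpa [q.comul_eq h] using q.counit_right h

theorem e1_Phi : q.e1 q.Phi = 1 := by
  let E : H ⊗[k] (H ⊗[k] (H ⊗[k] H)) →ₐ[k] H ⊗[k] (H ⊗[k] H) :=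
    Algebra.TensorProduct.map (AlgHom.id k H) (q.epsL _)
  let J : H ⊗[k] H →ₐ[k] H ⊗[k] (H ⊗[k] H) := Algebra.TensorProduct.includeRight
  let K : H ⊗[k] H →ₐ[k] H ⊗[k] (H ⊗[k] H) :=
    Algebra.TensorProduct.map (AlgHom.id k H) q.comul
  let L : H ⊗[k] H →ₐ[k] H ⊗[k] (H ⊗[k] H) :=
    Algebra.TensorProduct.map (AlgHom.id k H) Algebra.TensorProduct.includeLeft
  have h3 (x) : E (q.D3 x) = K (q.e2 x) := by
    induction x using tensor_induction₃ with
    | pure a b c => simp [E, K, D3]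
    | add x y hx hy => simp only [map_add, hx, hy]
  have h1 (x) : E (q.D1 x) = x := by
    induction x using tensor_induction₃ with
    | pure a b c =>
      conv_rhs => rw [← q.epsR_comul a]
      simp [E, D1, q.comul_eq a, sum_tmul, smul_tmul]
    | add x y hx hy => simp only [map_add, hx, hy]
  have h2 (x) : E (q.D2 x) = x := by
    induction x using tensor_induction₃ with
    | pure a b c =>
      conv_rhs => rw [← q.epsL_comul b]
      simp [E, D2, q.comul_eq b, sum_tmul, tmul_sum, smul_tmul]
    | add x y hx hy => simp only [map_add, hx, hy]
  have h4 (x) : E (I4 x) = L (q.e2 x) := by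
    induction x using tensor_induction₃ with
    | pure a b c => simp [E, L, I4]
    | add x y hx hy => simp only [map_add, hx, hy]
  have h5 (x) : E (I1 x) = J (q.e1 x) := by
    induction x using tensor_induction₃ with
    | pure a b c => simp [E, J, I1]
    | add x y hx hy => simp only [map_add, hx, hy]
  have h := congr(E $(q.pentagon_Phi))
  simp only [map_mul, h1, h2, h3, h4, h5, e2_Phi, map_one, one_mul, mul_one] at h
  have h' := congr(q.epsL _ ($h * q.PhiInv))
  rw [mul_assoc, Phi_mul_PhiInv, mul_one, map_one] at h'
  simpa [J] using h'.symm

theorem e3_Phi : q.e3 q.Phi = 1 := by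
  let E : H ⊗[k] (H ⊗[k] (H ⊗[k] H)) →ₐ[k] H ⊗[k] (H ⊗[k] H) :=
    Algebra.TensorProduct.map (AlgHom.id k H)
      (Algebra.TensorProduct.map (AlgHom.id k H) (q.epsL _))
  let J : H ⊗[k] H →ₐ[k] H ⊗[k] (H ⊗[k] H) :=
    Algebra.TensorProduct.map (AlgHom.id k H) Algebra.TensorProduct.includeLeft
  let K : H ⊗[k] H →ₐ[k] H ⊗[k] (H ⊗[k] H) :=
    (Algebra.TensorProduct.assoc k k k H H H).toAlgHom.comp
      (Algebra.TensorProduct.map q.comul (AlgHom.id k H))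
  let L : H ⊗[k] H →ₐ[k] H ⊗[k] (H ⊗[k] H) := Algebra.TensorProduct.includeRight
  have h3 (x) : E (q.D3 x) = x := by
    induction x using tensor_induction₃ with
    | pure a b c =>
      conv_rhs => rw [← q.epsL_comul c]
      simp [E, D3, q.comul_eq c, tmul_sum]
    | add x y hx hy => simp only [map_add, hx, hy]
  have h1 (x) : E (q.D1 x) = K (q.e2 x) := by
    induction x using tensor_induction₃ with
    | pure a b c =>
      simp [E, K, D1, q.comul_eq a, sum_tmul, Finset.smul_sum]
    | add x y hx hy => simp only [map_add, hx, hy]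
  have h2 (x) : E (q.D2 x) = x := by
    induction x using tensor_induction₃ with
    | pure a b c =>
      conv_rhs => rw [← q.epsR_comul b]
      simp [E, D2, q.comul_eq b, sum_tmul, tmul_sum, smul_tmul]
    | add x y hx hy => simp only [map_add, hx, hy]
  have h4 (x) : E (I4 x) = J (q.e3 x) := by
    induction x using tensor_induction₃ with
    | pure a b c => simp [E, J, I4]
    | add x y hx hy => simp only [map_add, hx, hy]
  have h5 (x) : E (I1 x) = L (q.e2 x) := by
    induction x using tensor_induction₃ with
    | pure a b c => simp [E, L, I1]
    | add x y hx hy => simp only [map_add, hx, hy]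
  have h := congr(E $(q.pentagon_Phi))
  simp only [map_mul, h1, h2, h3, h4, h5, e2_Phi, map_one, one_mul, mul_one] at h
  have h' := congr(q.PhiInv * $h)
  rw [← mul_assoc, PhiInv_mul_Phi, one_mul] at h'
  have hE (x : H ⊗[k] H) :
      Algebra.TensorProduct.map (AlgHom.id k H) q.epsR (J x) = x := by
    induction x using TensorProduct.induction_on with
    | zero => simp
    | tmul a b => simp [J]
    | add x y hx hy => simp only [map_add, hx, hy]
  rw [← hE (q.e3 q.Phi), ← h', map_one]

theorem e1_PhiInv : q.e1 q.PhiInv = 1 := by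
  simpa [e1_Phi] using q.map_Phi_mul q.e1

theorem e3_PhiInv : q.e3 q.PhiInv = 1 := by
  simpa [e3_Phi] using q.map_Phi_mul q.e3

@[simp]
theorem sswap_tmul (a b : H) : q.sswap (a ⊗ₜ b) = q.S b ⊗ₜ q.S a := rfl

@[simp]
theorem sswapInv_tmul (a b : H) : q.sswapInv (a ⊗ₜ b) = q.Sinv b ⊗ₜ q.Sinv a := rfl

theorem sswap_mul (x y : H ⊗[k] H) : q.sswap (x * y) = q.sswap y * q.sswap x := by
  induction x using TensorProduct.induction_on with
  | zero => simp
  | add x x' hx hx' => simp only [add_mul, mul_add, map_add, hx, hx']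
  | tmul a b =>
    induction y using TensorProduct.induction_on with
    | zero => simp
    | add y y' hy hy' => simp only [add_mul, mul_add, map_add, hy, hy']
    | tmul c d => simp [q.S_mul]

theorem scop_eq (h : H) : q.scop h = q.sswap (q.comul h) := by
  simp [scop, q.comul_eq h]

theorem scop_mul (x y : H) : q.scop (x * y) = q.scop y * q.scop x := by
  simp only [scop_eq, map_mul, sswap_mul]

theorem sum_alpha (h a b : H) :
    ∑ i ∈ Finset.range (q.n h), q.S (q.d1 h i * a) * q.alpha * (q.d2 h i * b) =
      q.counit h • (q.S a * q.alpha * b) := by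
  have := congr(q.S a * $(q.antipode_alpha h) * b)
  simpa only [Finset.mul_sum, Finset.sum_mul, q.S_mul, mul_assoc, mul_smul_comm,
    smul_mul_assoc] using this

theorem sum_beta (h a b : H) :
    ∑ i ∈ Finset.range (q.n h), a * q.d1 h i * q.beta * q.S (b * q.d2 h i) =
      q.counit h • (a * q.beta * q.S b) := by
  have := congr(a * $(q.antipode_beta h) * q.S b)
  simpa only [Finset.mul_sum, Finset.sum_mul, q.S_mul, mul_assoc, mul_smul_comm,
    smul_mul_assoc] using this

/-- `(Δ ⊗ id)(Δ h)` -/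
def C1 (h : H) : H ⊗[k] (H ⊗[k] H) :=
  ∑ i ∈ Finset.range (q.n h),
    Algebra.TensorProduct.assoc k k k H H H (q.comul (q.d1 h i) ⊗ₜ q.d2 h i)

/-- `(id ⊗ Δ)(Δ h)` -/
def C2 (h : H) : H ⊗[k] (H ⊗[k] H) :=
  ∑ i ∈ Finset.range (q.n h), q.d1 h i ⊗ₜ q.comul (q.d2 h i)

theorem C2_eq (h : H) : q.C2 h = q.Phi * q.C1 h * q.PhiInv := by
  have : q.C1 h = ∑ i ∈ Finset.range (q.n h), ∑ j ∈ Finset.range (q.n (q.d1 h i)),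
      q.d1 (q.d1 h i) j ⊗ₜ[k] (q.d2 (q.d1 h i) j ⊗ₜ[k] q.d2 h i) := by
    refine Finset.sum_congr rfl fun i _ => ?_
    simp [q.comul_eq (q.d1 h i), sum_tmul]
  rw [this]
  exact q.qcoassoc h

theorem C2_mul_Phi (h : H) : q.C2 h * q.Phi = q.Phi * q.C1 h := by
  rw [C2_eq, mul_assoc, PhiInv_mul_Phi, mul_one]

theorem PhiInv_mul_C2 (h : H) : q.PhiInv * q.C2 h = q.C1 h * q.PhiInv := by
  rw [C2_eq, ← mul_assoc, ← mul_assoc, PhiInv_mul_Phi, one_mul]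

/-- `a ⊗ b ⊗ c ↦ S(a) α b ⊗ c`, which sends `φ⁻¹` to `q^L`. -/
def qLMap : H ⊗[k] (H ⊗[k] H) →ₗ[k] H ⊗[k] H :=
  lin₃ fun a b c => (q.S a * q.alpha * b) ⊗ₜ c

theorem qLMap_PhiInv : q.qLMap q.PhiInv = q.qLE := by
  simp [qLMap, PhiInv, qLE, qL1, qL2]

theorem qLMap_mul (w : H ⊗[k] (H ⊗[k] H)) (x : H) (z : H ⊗[k] H) :
    q.qLMap (w * (x ⊗ₜ z)) = (q.S x ⊗ₜ 1) * q.qLMap w * z := by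
  induction w using tensor_induction₃ with
  | add w w' h h' => simp only [add_mul, mul_add, map_add, h, h']
  | pure a b c =>
    induction z using TensorProduct.induction_on with
    | zero => simp
    | add y y' hy hy' => simp only [mul_add, map_add, hy, hy', tmul_add]
    | tmul u v => simp [qLMap, q.S_mul, mul_assoc]

theorem qLMap_comul_mul (x y : H) (w : H ⊗[k] (H ⊗[k] H)) :
    q.qLMap (Algebra.TensorProduct.assoc k k k H H H (q.comul x ⊗ₜ y) * w) =
      q.counit x • ((1 ⊗ₜ y) * q.qLMap w) := by
  induction w using tensor_induction₃ with
  | add w w' h h' => simp only [mul_add, map_add, h, h', smul_add]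
  | pure a b c =>
    simp only [q.comul_eq x, sum_tmul, map_sum, Finset.sum_mul, Algebra.TensorProduct.assoc_tmul,
      tmul_mul_tmul, qLMap, lin₃_tmul]
    rw [← sum_tmul, sum_alpha, one_mul, smul_tmul']

/-- `x ⊗ y ↦ (S(x) ⊗ 1) q^L Δ(y)` -/
def G : H ⊗[k] H →ₗ[k] H ⊗[k] H :=
  lin₂ fun x y => (q.S x ⊗ₜ 1) * q.qLE * q.comul y

theorem G_tmul (x y : H) : q.G (x ⊗ₜ y) = (q.S x ⊗ₜ 1) * q.qLE * q.comul y := rfl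

theorem G_comul (h : H) : q.G (q.comul h) = (1 ⊗ₜ h) * q.qLE := by
  have hx := congr(q.qLMap $(q.PhiInv_mul_C2 h))
  simp only [C1, C2, Finset.mul_sum, Finset.sum_mul, map_sum, qLMap_mul, qLMap_comul_mul,
    qLMap_PhiInv] at hx
  simp only [q.comul_eq h, map_sum, G_tmul, hx, ← smul_mul_assoc, ← tmul_smul]
  rw [← Finset.sum_mul, ← tmul_sum, q.counit_left]

theorem G_mul_tmul (x : H ⊗[k] H) (a b : H) :
    q.G (x * (a ⊗ₜ b)) = (q.S a ⊗ₜ 1) * q.G x * q.comul b := by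
  induction x using TensorProduct.induction_on with
  | zero => simp
  | add x x' hx hx' => simp only [add_mul, mul_add, map_add, hx, hx']
  | tmul u v =>
    simp only [tmul_mul_tmul, G_tmul, q.S_mul, map_mul, ← mul_assoc, one_mul]

theorem G_comul_mul (h : H) (x : H ⊗[k] H) :
    q.G (q.comul h * x) = (1 ⊗ₜ h) * q.G x := by
  induction x using TensorProduct.induction_on with
  | zero => simp
  | add x x' hx hx' => simp only [mul_add, map_add, hx, hx']
  | tmul u v =>
    rw [G_mul_tmul, G_comul, G_tmul]
    simp only [← mul_assoc, tmul_mul_tmul, one_mul, mul_one]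

/-- `a ⊗ b ⊗ c ↦ a ⊗ b β S(c)`, which sends `φ⁻¹` to `p^R`. -/
def pRMap : H ⊗[k] (H ⊗[k] H) →ₗ[k] H ⊗[k] H :=
  lin₃ fun a b c => a ⊗ₜ (b * q.beta * q.S c)

theorem pRMap_PhiInv : q.pRMap q.PhiInv = q.pRE := by
  simp [pRMap, PhiInv, pRE, pR1, pR2]

theorem pRMap_assoc_mul (w : H ⊗[k] (H ⊗[k] H)) (x : H) (z : H ⊗[k] H) :
    q.pRMap (Algebra.TensorProduct.assoc k k k H H H (z ⊗ₜ x) * w) =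
      z * q.pRMap w * (1 ⊗ₜ q.S x) := by
  induction w using tensor_induction₃ with
  | add w w' h h' => simp only [add_mul, mul_add, map_add, h, h']
  | pure a b c =>
    induction z using TensorProduct.induction_on with
    | zero => simp
    | add y y' hy hy' => simp only [add_mul, map_add, hy, hy', add_tmul]
    | tmul u v => simp [pRMap, q.S_mul, mul_assoc]

theorem pRMap_mul_comul (x y : H) (w : H ⊗[k] (H ⊗[k] H)) :
    q.pRMap (w * (x ⊗ₜ q.comul y)) = q.counit y • (q.pRMap w * (x ⊗ₜ 1)) := by
  induction w using tensor_induction₃ with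
  | add w w' h h' => simp only [add_mul, map_add, h, h', smul_add]
  | pure a b c =>
    simp only [q.comul_eq y, tmul_sum, map_sum, Finset.mul_sum,
      tmul_mul_tmul, pRMap, lin₃_tmul]
    rw [← tmul_sum, sum_beta, mul_one, tmul_smul]

theorem pRE_mul (h : H) : ∑ i ∈ Finset.range (q.n h),
    q.comul (q.d1 h i) * q.pRE * (1 ⊗ₜ q.S (q.d2 h i)) = q.pRE * (h ⊗ₜ 1) := by
  have hx := congr(q.pRMap $(q.PhiInv_mul_C2 h))
  simp only [C1, C2, Finset.mul_sum, Finset.sum_mul, map_sum, pRMap_assoc_mul, pRMap_mul_comul,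
    pRMap_PhiInv] at hx
  simp only [← hx, ← mul_smul_comm, smul_tmul']
  rw [← Finset.mul_sum, ← sum_tmul, q.counit_right]

/-- `S(p^R_1) q^L_1 p^R_2₍₁₎ ⊗ q^L_2 p^R_2₍₂₎` -/
def VR' : H ⊗[k] H := q.G q.pRE

theorem S_mul_VR' (h : H) : (q.S h ⊗ₜ 1) * q.VR' = ∑ i ∈ Finset.range (q.n h),
    (1 ⊗ₜ q.d1 h i) * q.VR' * q.comul (q.S (q.d2 h i)) := by
  have hx := congr(q.G $(q.pRE_mul h))
  rw [G_mul_tmul, map_one, mul_one] at hx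
  rw [VR', ← hx, map_sum]
  refine Finset.sum_congr rfl fun i _ => ?_
  rw [G_mul_tmul, G_comul_mul, q.S_one, ← Algebra.TensorProduct.one_def, one_mul]

/-- `x ⊗ y ↦ x ⊗ y ⊗ 1 ⊗ 1` -/
def J12 : H ⊗[k] H →ₐ[k] H ⊗[k] (H ⊗[k] (H ⊗[k] H)) :=
  Algebra.TensorProduct.map (AlgHom.id k H) Algebra.TensorProduct.includeLeft

/-- `x ⊗ y ↦ x ⊗ 1 ⊗ 1 ⊗ y` -/
def J14 : H ⊗[k] H →ₐ[k] H ⊗[k] (H ⊗[k] (H ⊗[k] H)) :=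
  Algebra.TensorProduct.map (AlgHom.id k H)
    (Algebra.TensorProduct.includeRight.comp Algebra.TensorProduct.includeRight)

/-- `x ⊗ y ↦ 1 ⊗ 1 ⊗ x ⊗ y` -/
def J34 : H ⊗[k] H →ₐ[k] H ⊗[k] (H ⊗[k] (H ⊗[k] H)) :=
  Algebra.TensorProduct.includeRight.comp Algebra.TensorProduct.includeRight

theorem J12_tmul (a b : H) : J12 (a ⊗ₜ[k] b) = a ⊗ₜ (b ⊗ₜ (1 ⊗ₜ 1)) := rfl

theorem J14_tmul (a b : H) : J14 (a ⊗ₜ[k] b) = a ⊗ₜ (1 ⊗ₜ (1 ⊗ₜ b)) := rfl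

theorem J34_tmul (a b : H) : J34 (a ⊗ₜ[k] b) = 1 ⊗ₜ (1 ⊗ₜ (a ⊗ₜ b)) := rfl

/-- `a ⊗ b ⊗ c ⊗ d ↦ a β S(b) α c ⊗ d` -/
def invMap : H ⊗[k] (H ⊗[k] (H ⊗[k] H)) →ₗ[k] H ⊗[k] H :=
  lin₄ fun a b c d => (a * q.beta * q.S b * q.alpha * c) ⊗ₜ d

theorem invMap_mul_D1 (x : H ⊗[k] (H ⊗[k] (H ⊗[k] H))) (y : H ⊗[k] (H ⊗[k] H)) :
    q.invMap (x * q.D1 y) = q.invMap (x * J34 (q.e1 y)) := by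
  induction y using tensor_induction₃ with
  | add y y' h h' => simp only [mul_add, map_add, h, h']
  | pure u v w =>
    induction x using tensor_induction₄ with
    | add x x' h h' => simp only [add_mul, map_add, h, h']
    | pure a b c d =>
      simp only [D1_tmul, e1_tmul, map_smul, J34_tmul, mul_smul_comm, Finset.mul_sum, map_sum,
        tmul_mul_tmul, invMap, lin₄_tmul, mul_one]
      rw [← sum_tmul, ← Finset.sum_mul, ← Finset.sum_mul, sum_beta, smul_mul_assoc,
        smul_mul_assoc, smul_tmul']

theorem invMap_D2_mul (x : H ⊗[k] (H ⊗[k] (H ⊗[k] H))) (y : H ⊗[k] (H ⊗[k] H)) :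
    q.invMap (q.D2 y * x) = q.invMap (J14 (q.e2 y) * x) := by
  induction y using tensor_induction₃ with
  | add y y' h h' => simp only [add_mul, map_add, h, h']
  | pure u v w =>
    induction x using tensor_induction₄ with
    | add x x' h h' => simp only [mul_add, map_add, h, h']
    | pure a b c d =>
      have hx (y z : H) :
          u * a * q.beta * y * q.alpha * z = u * a * q.beta * (y * q.alpha * z) := by
        simp only [mul_assoc]
      simp only [D2_tmul, e2_tmul, map_smul, J14_tmul, smul_mul_assoc, Finset.sum_mul, map_sum,
        tmul_mul_tmul, invMap, lin₄_tmul, one_mul, hx]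
      rw [← sum_tmul, ← Finset.mul_sum, sum_alpha, mul_smul_comm, smul_tmul']

theorem invMap_I4_Phi : q.invMap (I4 q.Phi) = 1 := by
  simp only [Phi, map_sum, I4_tmul, invMap, lin₄_tmul]
  rw [← sum_tmul, q.nondeg_1, Algebra.TensorProduct.one_def]

theorem invMap_I1_mul_D3 (y : H ⊗[k] (H ⊗[k] H)) (a b c : H) :
    q.invMap (I1 y * q.D3 (a ⊗ₜ (b ⊗ₜ c))) =
      ((a * q.beta * q.S b) ⊗ₜ 1) * q.qLMap y * q.comul c := by
  induction y using tensor_induction₃ with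
  | add y y' h h' => simp only [add_mul, mul_add, map_add, h, h']
  | pure u v w =>
    simp only [D3_tmul, I1_apply, Finset.mul_sum, map_sum, tmul_mul_tmul, invMap, lin₄_tmul,
      q.comul_eq c, qLMap, lin₃_tmul, q.S_mul, one_mul, mul_assoc]

theorem G_pLE : q.G q.pLE = 1 := by
  have h := congr(q.invMap $(q.I1_mul_D3))
  rw [invMap_mul_D1, e1_PhiInv, map_one, mul_one, invMap_D2_mul, e2_Phi, map_one, one_mul,
    invMap_I4_Phi] at h
  rw [← h]
  conv_rhs => rw [Phi]
  simp only [map_sum, Finset.mul_sum, invMap_I1_mul_D3, qLMap_PhiInv, pLE, G_tmul, pL1, pL2,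
    q.S_mul, q.S_Sinv]

/-- `a ⊗ b ⊗ c ↦ (S(b) ⊗ S(a) α) q^L Δ(c)`, which sends `φ` to `𝕒`. -/
def aMap : H ⊗[k] (H ⊗[k] H) →ₗ[k] H ⊗[k] H :=
  lin₃ fun a b c => (q.S b ⊗ₜ (q.S a * q.alpha)) * q.qLE * q.comul c

theorem aMap_tmul (a b c : H) : q.aMap (a ⊗ₜ (b ⊗ₜ c)) =
    (q.S b ⊗ₜ (q.S a * q.alpha)) * q.qLE * q.comul c := rfl

theorem aMap_Phi : q.aMap q.Phi = q.aEl := by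
  simp only [Phi, map_sum, aMap_tmul, aEl]
  refine Finset.sum_congr rfl fun a _ => ?_
  simp only [qLE, q.comul_eq (q.P3 a), Finset.mul_sum, Finset.sum_mul, tmul_mul_tmul, qL1, qL2,
    q.S_mul, mul_assoc]
  exact Finset.sum_comm

theorem aMap_mul (w : H ⊗[k] (H ⊗[k] H)) (x y : H) :
    q.aMap (w * Algebra.TensorProduct.assoc k k k H H H (q.comul x ⊗ₜ y)) =
      q.scop x * q.aMap w * q.comul y := by
  induction w using tensor_induction₃ with
  | add w w' h h' => simp only [add_mul, mul_add, map_add, h, h']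
  | pure a b c =>
    simp only [q.comul_eq x, sum_tmul, map_sum, Finset.mul_sum, Algebra.TensorProduct.assoc_tmul,
      tmul_mul_tmul, aMap_tmul, scop, Finset.sum_mul, q.S_mul, map_mul, ← mul_assoc]

/-- `a ⊗ b ⊗ c ⊗ d ↦ (S(b) ⊗ S(a) α) q^L Δ(c β S(d))` -/
def twistMap : H ⊗[k] (H ⊗[k] (H ⊗[k] H)) →ₗ[k] H ⊗[k] H :=
  lin₄ fun a b c d => (q.S b ⊗ₜ (q.S a * q.alpha)) * q.qLE * q.comul (c * q.beta * q.S d)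

theorem twistMap_mul_D3 (x : H ⊗[k] (H ⊗[k] (H ⊗[k] H))) (y : H ⊗[k] (H ⊗[k] H)) :
    q.twistMap (x * q.D3 y) = q.twistMap (x * J12 (q.e3 y)) := by
  induction y using tensor_induction₃ with
  | add y y' h h' => simp only [mul_add, map_add, h, h']
  | pure u v w =>
    induction x using tensor_induction₄ with
    | add x x' h h' => simp only [add_mul, map_add, h, h']
    | pure a b c d =>
      simp only [D3_tmul, e3_tmul, map_smul, J12_tmul, mul_smul_comm, Finset.mul_sum, map_sum,
        tmul_mul_tmul, twistMap, lin₄_tmul, mul_one]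
      rw [← Finset.mul_sum, ← map_sum, sum_beta, map_smul, mul_smul_comm]

theorem twistMap_I4_mul_D1 (w : H ⊗[k] (H ⊗[k] H)) (a b c : H) :
    q.twistMap (I4 w * q.D1 (a ⊗ₜ (b ⊗ₜ c))) =
      q.scop a * q.aMap w * q.comul (b * q.beta * q.S c) := by
  induction w using tensor_induction₃ with
  | add w w' h h' => simp only [add_mul, mul_add, map_add, h, h']
  | pure u v w =>
    simp only [D1_tmul, I4_tmul, Finset.mul_sum, map_sum, Finset.sum_mul, tmul_mul_tmul, twistMap,
      lin₄_tmul, aMap_tmul, scop, q.S_mul, map_mul, ← mul_assoc, one_mul]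

theorem twistMap_D2_mul_I1 (w : H ⊗[k] (H ⊗[k] H)) (a b c : H) :
    q.twistMap (q.D2 (a ⊗ₜ (b ⊗ₜ c)) * I1 w) =
      (1 ⊗ₜ (q.S a * q.alpha)) * q.G (q.comul b * q.pRMap w) * q.comul (q.S c) := by
  induction w using tensor_induction₃ with
  | add w w' h h' => simp only [mul_add, add_mul, map_add, h, h']
  | pure u v w =>
    simp only [D2_tmul, I1_apply, Finset.mul_sum, map_sum, Finset.sum_mul, tmul_mul_tmul, twistMap,
      lin₄_tmul, pRMap, lin₃_tmul, q.comul_eq b, G_tmul, q.S_mul, map_mul, ← mul_assoc, one_mul,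
      mul_one]

theorem twist_eq : q.twist = ∑ b ∈ Finset.range q.nq,
    (1 ⊗ₜ q.qL1 b) * q.VR' * q.comul (q.S (q.qL2 b)) := by
  have h := congr(q.twistMap $(q.I4_mul_D1_mul_D3))
  rw [twistMap_mul_D3, e3_PhiInv, map_one, mul_one] at h
  have h₁ : q.twistMap (I4 q.Phi * q.D1 q.PhiInv) = q.twist := by
    conv_lhs => arg 2; arg 2; rw [PhiInv]
    simp only [map_sum, Finset.mul_sum, twistMap_I4_mul_D1, aMap_Phi, twist, pR1, pR2]
  rw [← h₁, h]
  conv_lhs => arg 2; arg 1; rw [PhiInv]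
  simp only [map_sum, Finset.sum_mul, twistMap_D2_mul_I1, pRMap_PhiInv, G_comul_mul, VR', qL1, qL2,
    ← mul_assoc, tmul_mul_tmul, one_mul]

/-- `x ⊗ y ↦ (1 ⊗ x) V Δ(S(y))` with `V = S(p^R_1) q^L_1 p^R_2₍₁₎ ⊗ q^L_2 p^R_2₍₂₎` -/
def vrMap : H ⊗[k] H →ₗ[k] H ⊗[k] H :=
  lin₂ fun x y => (1 ⊗ₜ x) * q.VR' * q.comul (q.S y)

theorem vrMap_tmul (x y : H) :
    q.vrMap (x ⊗ₜ y) = (1 ⊗ₜ x) * q.VR' * q.comul (q.S y) := rfl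

theorem vrMap_tmul_mul_comul (x h : H) (z : H ⊗[k] H) :
    q.vrMap ((x ⊗ₜ 1) * z * q.comul h) = (q.S h ⊗ₜ x) * q.vrMap z := by
  induction z using TensorProduct.induction_on with
  | zero => simp
  | add z z' hz hz' => simp only [mul_add, add_mul, map_add, hz, hz']
  | tmul u v =>
    have hx : (q.S h ⊗ₜ x) * q.vrMap (u ⊗ₜ v) =
        (1 ⊗ₜ (x * u)) * ((q.S h ⊗ₜ 1) * q.VR') * q.comul (q.S v) := by
      simp only [vrMap_tmul, ← mul_assoc, tmul_mul_tmul, one_mul, mul_one]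
    rw [hx, S_mul_VR']
    simp only [q.comul_eq h, Finset.mul_sum, Finset.sum_mul, map_sum, tmul_mul_tmul, vrMap_tmul,
      q.S_mul, map_mul, ← mul_assoc, one_mul]

theorem VR'_eq : q.VR' = q.sswap q.pLE * q.twist := by
  have h := congr(q.vrMap $(q.G_pLE))
  have h1 : q.vrMap 1 = q.VR' := by
    rw [Algebra.TensorProduct.one_def, vrMap_tmul, q.S_one, map_one, mul_one,
      ← Algebra.TensorProduct.one_def, one_mul]
  have h2 : q.vrMap q.qLE = q.twist := by
    rw [twist_eq, qLE, map_sum]; rfl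
  rw [h1] at h
  rw [← h, pLE, map_sum, map_sum, map_sum, Finset.sum_mul]
  refine Finset.sum_congr rfl fun a _ => ?_
  rw [G_tmul, vrMap_tmul_mul_comul, h2, sswap_tmul]

theorem aMap_mul_tmul_comul (x y : H) (w : H ⊗[k] (H ⊗[k] H)) :
    q.aMap ((x ⊗ₜ q.comul y) * w) =
      (lin₃ fun a b c => (q.S b ⊗ₜ (q.S a * (q.S x * q.alpha * y))) * q.qLE * q.comul c :
        H ⊗[k] (H ⊗[k] H) →ₗ[k] H ⊗[k] H) w := by
  induction w using tensor_induction₃ with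
  | add w w' h h' => simp only [mul_add, map_add, h, h']
  | pure a b c =>
    have hx : q.aMap ((x ⊗ₜ q.comul y) * (a ⊗ₜ (b ⊗ₜ c))) =
        (q.S b ⊗ₜ (q.S (x * a) * q.alpha)) * q.G (q.comul y) * q.comul c := by
      simp only [q.comul_eq y, tmul_sum, map_sum, Finset.mul_sum, Finset.sum_mul, tmul_mul_tmul,
        aMap_tmul, G_tmul, q.S_mul, map_mul, ← mul_assoc, mul_one]
    rw [hx, G_comul, lin₃_tmul]
    simp only [← mul_assoc, tmul_mul_tmul, mul_one, q.S_mul]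

theorem sum_scop_mul_aEl (h : H) : ∑ i ∈ Finset.range (q.n h),
    q.scop (q.d1 h i) * q.aEl * q.comul (q.d2 h i) = q.counit h • q.aEl := by
  have hx := congr(q.aMap $(q.C2_mul_Phi h))
  simp only [C1, C2, Finset.mul_sum, Finset.sum_mul, map_sum, aMap_mul, aMap_mul_tmul_comul,
    aMap_Phi] at hx
  rw [← hx, ← aMap_Phi, Phi]
  simp only [map_sum, lin₃_tmul, aMap_tmul, Finset.smul_sum]
  rw [Finset.sum_comm]
  refine Finset.sum_congr rfl fun a _ => ?_
  rw [← Finset.sum_mul, ← Finset.sum_mul, ← tmul_sum, ← Finset.mul_sum, q.antipode_alpha,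
    mul_smul_comm, tmul_smul, smul_mul_assoc, smul_mul_assoc]

/-- `x ⊗ y ↦ (S ⊗ S)(Δ^cop x) 𝕒 Δ(y)` -/
def scopMap : H ⊗[k] H →ₗ[k] H ⊗[k] H :=
  lin₂ (fun x y => q.sswap (q.comul x) * q.aEl * q.comul y)

theorem scopMap_tmul (x y : H) :
    q.scopMap (x ⊗ₜ y) = q.scop x * q.aEl * q.comul y := by
  rw [scop_eq]; rfl

theorem scopMap_mul_tmul (z : H ⊗[k] H) (x y : H) :
    q.scopMap (z * (x ⊗ₜ y)) = q.scop x * q.scopMap z * q.comul y := by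
  induction z using TensorProduct.induction_on with
  | zero => simp
  | add z z' hz hz' => simp only [mul_add, add_mul, map_add, hz, hz']
  | tmul u v => simp only [tmul_mul_tmul, scopMap_tmul, scop_mul, map_mul, mul_assoc]

theorem scopMap_comul_mul (h : H) (z : H ⊗[k] H) :
    q.scopMap (q.comul h * z) = q.counit h • q.scopMap z := by
  induction z using TensorProduct.induction_on with
  | zero => simp
  | add z z' hz hz' => simp only [mul_add, map_add, hz, hz', smul_add]
  | tmul u v =>
    have : q.scopMap (q.comul h) = q.counit h • q.aEl := by
      rw [← sum_scop_mul_aEl, q.comul_eq h, map_sum]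
      simp only [scopMap_tmul]
    rw [scopMap_mul_tmul, this, scopMap_tmul, mul_smul_comm, smul_mul_assoc]

theorem scopMap_pRE : q.scopMap q.pRE = q.twist := by
  rw [pRE, map_sum, twist]
  simp only [scopMap_tmul]

theorem scop_mul_twist (h : H) : q.scop h * q.twist = q.twist * q.comul (q.S h) := by
  have hx := congr(q.scopMap $(q.pRE_mul h))
  rw [scopMap_mul_tmul, map_one, mul_one, scopMap_pRE] at hx
  rw [← hx, map_sum]
  have h1 : q.scop 1 = 1 := by
    simp [scop_eq, Algebra.TensorProduct.one_def, q.S_one]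
  have (i : ℕ) : q.scopMap (q.comul (q.d1 h i) * q.pRE * (1 ⊗ₜ q.S (q.d2 h i))) =
      q.twist * q.comul (q.S (q.counit (q.d1 h i) • q.d2 h i)) := by
    rw [scopMap_mul_tmul, scopMap_comul_mul, scopMap_pRE, h1, one_mul, map_smul, map_smul,
      mul_smul_comm, smul_mul_assoc]
  simp only [this]
  rw [← Finset.mul_sum, ← map_sum, ← map_sum, q.counit_left]

/-- `a ⊗ b ⊗ c ⊗ d ↦ (S ⊗ S)(Δ^cop a) 𝕒 Δ(b β S(c) α d)` -/
def twistAlphaMap : H ⊗[k] (H ⊗[k] (H ⊗[k] H)) →ₗ[k] H ⊗[k] H :=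
  lin₄ (fun a b c d => q.scopMap (a ⊗ₜ (b * q.beta * q.S c * q.alpha * d)))

theorem twistAlphaMap_D1_mul (x : H ⊗[k] (H ⊗[k] (H ⊗[k] H))) (y : H ⊗[k] (H ⊗[k] H)) :
    q.twistAlphaMap (q.D1 y * x) = q.twistAlphaMap (J34 (q.e1 y) * x) := by
  induction y using tensor_induction₃ with
  | add y y' h h' => simp only [add_mul, map_add, h, h']
  | pure u v w =>
    induction x using tensor_induction₄ with
    | add x x' h h' => simp only [mul_add, map_add, h, h']
    | pure a b c d =>
      have hx := q.scopMap_comul_mul u (a ⊗ₜ (b * q.beta * q.S (v * c) * q.alpha * (w * d)))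
      simp only [q.comul_eq u, Finset.sum_mul, map_sum, tmul_mul_tmul, ← mul_assoc] at hx
      simp only [D1_tmul, e1_tmul, map_smul, J34_tmul, smul_mul_assoc, Finset.sum_mul, map_sum,
        tmul_mul_tmul, twistAlphaMap, lin₄_tmul, one_mul, ← mul_assoc, hx]

theorem twistAlphaMap_D3_mul (x : H ⊗[k] (H ⊗[k] (H ⊗[k] H))) (y : H ⊗[k] (H ⊗[k] H)) :
    q.twistAlphaMap (q.D3 y * x) = q.twistAlphaMap (J12 (q.e3 y) * x) := by
  induction y using tensor_induction₃ with
  | add y y' h h' => simp only [add_mul, map_add, h, h']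
  | pure u v w =>
    induction x using tensor_induction₄ with
    | add x x' h h' => simp only [mul_add, map_add, h, h']
    | pure a b c d =>
      have hx (y z : H) :
          v * b * q.beta * y * q.alpha * z = v * b * q.beta * (y * q.alpha * z) := by
        simp only [mul_assoc]
      simp only [D3_tmul, e3_tmul, map_smul, J12_tmul, smul_mul_assoc, Finset.sum_mul, map_sum,
        tmul_mul_tmul, twistAlphaMap, lin₄_tmul, one_mul, hx]
      rw [← map_sum, ← tmul_sum, ← Finset.mul_sum, sum_alpha, mul_smul_comm, tmul_smul, map_smul]

theorem twistAlphaMap_mul_D2 (x : H ⊗[k] (H ⊗[k] (H ⊗[k] H))) (y : H ⊗[k] (H ⊗[k] H)) :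
    q.twistAlphaMap (x * q.D2 y) = q.twistAlphaMap (x * J14 (q.e2 y)) := by
  induction y using tensor_induction₃ with
  | add y y' h h' => simp only [mul_add, map_add, h, h']
  | pure u v w =>
    induction x using tensor_induction₄ with
    | add x x' h h' => simp only [add_mul, map_add, h, h']
    | pure a b c d =>
      simp only [D2_tmul, e2_tmul, map_smul, J14_tmul, mul_smul_comm, Finset.mul_sum, map_sum,
        tmul_mul_tmul, twistAlphaMap, lin₄_tmul, mul_one]
      rw [← map_sum, ← tmul_sum, ← Finset.sum_mul, ← Finset.sum_mul, sum_beta, smul_mul_assoc,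
        smul_mul_assoc, tmul_smul, map_smul]

theorem twist_mul_comul_alpha : q.twist * q.comul q.alpha = q.aEl := by
  have h := congr(q.twistAlphaMap $(q.I4_PhiInv))
  rw [mul_assoc, twistAlphaMap_D1_mul, e1_PhiInv, map_one, one_mul, twistAlphaMap_D3_mul,
    e3_PhiInv, map_one, one_mul, twistAlphaMap_mul_D2, e2_Phi, map_one, mul_one] at h
  have h1 : q.twistAlphaMap (I4 q.PhiInv) = q.twist * q.comul q.alpha := by
    simp only [PhiInv, map_sum, I4_tmul, twistAlphaMap, lin₄_tmul, twist, scopMap_tmul,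
      pR1, pR2, Finset.sum_mul, map_mul, map_one, mul_one, mul_assoc]
  have h2 : q.twistAlphaMap (I1 q.Phi) = q.aEl := by
    simp only [Phi, I1_apply, map_sum, twistAlphaMap, lin₄_tmul]
    rw [← map_sum, ← tmul_sum, q.nondeg_1, scopMap_tmul, scop_eq]
    simp [Algebra.TensorProduct.one_def, q.S_one]
    simp [← Algebra.TensorProduct.one_def]
  rw [← h1, h, h2]

/-- `a ⊗ b ⊗ c ⊗ d ↦ S(b) α c ⊗ S(a) α d` -/
def alphaMap : H ⊗[k] (H ⊗[k] (H ⊗[k] H)) →ₗ[k] H ⊗[k] H :=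
  lin₄ (fun a b c d => (q.S b * q.alpha * c) ⊗ₜ (q.S a * q.alpha * d))

theorem alphaMap_D2_mul (x : H ⊗[k] (H ⊗[k] (H ⊗[k] H))) (y : H ⊗[k] (H ⊗[k] H)) :
    q.alphaMap (q.D2 y * x) = q.alphaMap (J14 (q.e2 y) * x) := by
  induction y using tensor_induction₃ with
  | add y y' h h' => simp only [add_mul, map_add, h, h']
  | pure u v w =>
    induction x using tensor_induction₄ with
    | add x x' h h' => simp only [mul_add, map_add, h, h']
    | pure a b c d =>
      simp only [D2_tmul, e2_tmul, map_smul, J14_tmul, smul_mul_assoc, Finset.sum_mul, map_sum,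
        tmul_mul_tmul, alphaMap, lin₄_tmul, one_mul]
      rw [← sum_tmul, sum_alpha, smul_tmul']

theorem alphaMap_I1_mul_D3 (y : H ⊗[k] (H ⊗[k] H)) (a b c : H) :
    q.alphaMap (I1 y * q.D3 (a ⊗ₜ (b ⊗ₜ c))) =
      (q.S b ⊗ₜ (q.S a * q.alpha)) * q.qLMap y * q.comul c := by
  induction y using tensor_induction₃ with
  | add y y' h h' => simp only [add_mul, mul_add, map_add, h, h']
  | pure u v w =>
    simp only [D3_tmul, I1_apply, Finset.mul_sum, map_sum, tmul_mul_tmul, alphaMap, lin₄_tmul,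
      q.comul_eq c, qLMap, lin₃_tmul, q.S_mul, one_mul, mul_assoc]

theorem aEl_eq : q.aEl = q.alphaMap (I4 q.Phi * q.D1 q.PhiInv) := by
  rw [I4_mul_D1, mul_assoc, alphaMap_D2_mul, e2_PhiInv, map_one, one_mul, ← aMap_Phi]
  conv_lhs => rw [Phi]
  conv_rhs => arg 2; arg 2; rw [Phi]
  simp only [map_sum, Finset.mul_sum, alphaMap_I1_mul_D3, qLMap_PhiInv, aMap_tmul]

/-- The Drinfeld twist is the only intertwiner `g` with `g Δ(α) = 𝕒`. -/
theorem eq_twist (g : H ⊗[k] H) (hg : ∀ h, q.scop h * g = g * q.comul (q.S h))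
    (hα : g * q.comul q.alpha = q.aEl) : g = q.twist := by
  have h1 : q.comul (∑ b ∈ Finset.range q.nq,
      q.S (q.Q1 b) * q.alpha * q.Q2 b * q.beta * q.S (q.Q3 b)) = 1 := by
    rw [q.nondeg_2, map_one]
  rw [← mul_one g, ← h1, map_sum, Finset.mul_sum, twist]
  refine Finset.sum_congr rfl fun b _ => ?_
  rw [← hα, ← mul_assoc (q.scop _), hg, pR1, pR2]
  simp only [map_mul, mul_assoc]

theorem Sinv_mul (x y : H) : q.Sinv (x * y) = q.Sinv y * q.Sinv x := by
  rw [← q.Sinv_S (q.Sinv y * q.Sinv x), q.S_mul, q.S_Sinv, q.S_Sinv]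

theorem Sinv_one : q.Sinv 1 = 1 := by
  simpa [q.S_one] using q.Sinv_S 1

theorem counit_S (h : H) : q.counit (q.S h) = q.counit h := by
  have h₁ := congr(q.counit $(q.antipode_alpha h))
  have h₂ := congr(q.counit (q.S $(q.counit_right h)))
  simp only [map_sum, map_mul, map_smul, q.counit_alpha, mul_one, smul_eq_mul] at h₁ h₂
  rw [← h₂, ← h₁]
  exact Finset.sum_congr rfl fun _ _ => mul_comm _ _

theorem counit_Sinv (h : H) : q.counit (q.Sinv h) = q.counit h := by
  rw [← q.counit_S, q.S_Sinv]

/-- `a ⊗ b ⊗ c ↦ c ⊗ b ⊗ a` -/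
def rev₃ : H ⊗[k] (H ⊗[k] H) →ₐ[k] H ⊗[k] (H ⊗[k] H) :=
  (Algebra.TensorProduct.assoc k k k H H H).toAlgHom.comp
    ((Algebra.TensorProduct.map (Algebra.TensorProduct.comm k H H).toAlgHom (AlgHom.id k H)).comp
      (Algebra.TensorProduct.comm k H (H ⊗[k] H)).toAlgHom)

theorem rev₃_tmul (a b c : H) : rev₃ (a ⊗ₜ[k] (b ⊗ₜ[k] c)) = c ⊗ₜ (b ⊗ₜ a) := rfl

/-- `a ⊗ b ⊗ c ⊗ d ↦ d ⊗ c ⊗ b ⊗ a` -/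
def rev₄ : H ⊗[k] (H ⊗[k] (H ⊗[k] H)) →ₐ[k] H ⊗[k] (H ⊗[k] (H ⊗[k] H)) :=
  (Algebra.TensorProduct.map (AlgHom.id k H)
    (Algebra.TensorProduct.assoc k k k H H H).toAlgHom).comp
    ((Algebra.TensorProduct.assoc k k k H (H ⊗[k] H) H).toAlgHom.comp
      ((Algebra.TensorProduct.comm k H (H ⊗[k] (H ⊗[k] H))).toAlgHom.comp
        (Algebra.TensorProduct.map (AlgHom.id k H) rev₃)))

theorem rev₄_tmul (a b c d : H) :
    rev₄ (a ⊗ₜ[k] (b ⊗ₜ[k] (c ⊗ₜ[k] d))) = d ⊗ₜ (c ⊗ₜ (b ⊗ₜ a)) := rfl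

/-- The coopposite quasi-Hopf algebra. -/
def cop : QuasiHopf k H where
  comul := (Algebra.TensorProduct.comm k H H).toAlgHom.comp q.comul
  counit := q.counit
  n := q.n
  d1 := q.d2
  d2 := q.d1
  comul_eq h := by simp [q.comul_eq h]
  np := q.nq
  P1 := q.Q3
  P2 := q.Q2
  P3 := q.Q1
  nq := q.np
  Q1 := q.P3
  Q2 := q.P2
  Q3 := q.P1
  S := q.Sinv
  Sinv := q.S
  alpha := q.Sinv q.alpha
  beta := q.Sinv q.beta
  S_one := q.Sinv_one
  S_mul := q.Sinv_mul
  Sinv_S := q.S_Sinv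
  S_Sinv := q.Sinv_S
  phi_phiInv := by
    have h := congr(rev₃ $(q.PhiInv_mul_Phi))
    simpa only [Phi, PhiInv, map_mul, map_sum, rev₃_tmul, map_one] using h
  phiInv_phi := by
    have h := congr(rev₃ $(q.Phi_mul_PhiInv))
    simpa only [Phi, PhiInv, map_mul, map_sum, rev₃_tmul, map_one] using h
  qcoassoc h := by
    have hC : q.C1 h = q.PhiInv * q.C2 h * q.Phi := by
      rw [PhiInv_mul_C2, mul_assoc, PhiInv_mul_Phi, mul_one]
    have h := congr(rev₃ $hC)
    simpa [C1, C2, Phi, PhiInv, q.comul_eq, sum_tmul, tmul_sum, rev₃_tmul] using h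
  counit_left := q.counit_right
  counit_right := q.counit_left
  pentagon := by
    have h := congr(rev₄ $(q.pentagon_PhiInv))
    simpa [PhiInv, D1_tmul, D2_tmul, D3_tmul, I4_tmul, I1_apply, q.comul_eq, tmul_sum,
      rev₄_tmul, mul_assoc] using h
  counit_mid_phi := by
    have h := congr(Algebra.TensorProduct.comm k H H $(q.e2_PhiInv))
    simpa [PhiInv, Algebra.TensorProduct.one_def] using h
  antipode_alpha h := by
    have := congr(q.Sinv $(q.antipode_alpha h))
    simpa [q.Sinv_mul, q.Sinv_S, mul_assoc] using this
  antipode_beta h := by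
    have := congr(q.Sinv $(q.antipode_beta h))
    simpa [q.Sinv_mul, q.Sinv_S, mul_assoc] using this
  nondeg_1 := by
    have := congr(q.Sinv $(q.nondeg_2))
    simpa [q.Sinv_mul, q.Sinv_S, q.Sinv_one, mul_assoc] using this
  nondeg_2 := by
    have := congr(q.Sinv $(q.nondeg_1))
    simpa [q.Sinv_mul, q.Sinv_S, q.Sinv_one, mul_assoc] using this
  counit_alpha := by rw [counit_Sinv, q.counit_alpha]
  counit_beta := by rw [counit_Sinv, q.counit_beta]

theorem sum_eq_VR' :
    ∑ b ∈ Finset.range q.nq, ∑ c ∈ Finset.range q.nq, ∑ m ∈ Finset.range (q.n (q.pR2 b)),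
      (q.S (q.pR1 b) * q.qL1 c * q.d1 (q.pR2 b) m) ⊗ₜ[k] (q.qL2 c * q.d2 (q.pR2 b) m)
      = q.VR' := by
  simp only [VR', pRE, map_sum, G_tmul, qLE, q.comul_eq (q.pR2 _), Finset.sum_mul, Finset.mul_sum,
    tmul_mul_tmul, one_mul]
  exact Finset.sum_congr rfl fun b _ => Finset.sum_comm

theorem sswapInv_mul (x y : H ⊗[k] H) :
    q.sswapInv (x * y) = q.sswapInv y * q.sswapInv x := q.cop.sswap_mul x y

/-- `S ⊗ S` -/
def SS : H ⊗[k] H →ₗ[k] H ⊗[k] H := TensorProduct.map q.S q.S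

@[simp]
theorem SS_tmul (a b : H) : q.SS (a ⊗ₜ b) = q.S a ⊗ₜ q.S b := rfl

theorem SS_mul (x y : H ⊗[k] H) : q.SS (x * y) = q.SS y * q.SS x := by
  induction x using TensorProduct.induction_on with
  | zero => simp
  | add x x' h h' => simp only [add_mul, mul_add, map_add, h, h']
  | tmul a b =>
    induction y using TensorProduct.induction_on with
    | zero => simp
    | add y y' h h' => simp only [add_mul, mul_add, map_add, h, h']
    | tmul c d => simp [q.S_mul]

theorem SS_cop_comul (h : H) : q.SS (q.cop.comul h) = q.scop h := by
  simp [cop, q.comul_eq h, scop]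

theorem SS_cop_scop (h : H) : q.SS (q.cop.scop h) = q.comul h := by
  simp [cop, scop, q.comul_eq h, q.S_Sinv]

theorem SS_cop_aEl : q.SS q.cop.aEl = q.aEl := by
  rw [q.aEl_eq]
  simp only [aEl, Phi, PhiInv, map_sum, I4_tmul, D1_tmul, Finset.sum_mul, Finset.mul_sum,
    tmul_mul_tmul, alphaMap, lin₄_tmul, one_mul, SS_tmul]
  simp only [cop, q.S_mul, q.S_Sinv, mul_assoc]
  exact Finset.sum_congr rfl fun _ _ => Finset.sum_comm

theorem SS_cop_twist : q.SS q.cop.twist = q.twist := by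
  have hg (h : H) : q.scop h * q.SS q.cop.twist = q.SS q.cop.twist * q.comul (q.S h) := by
    have := congr(q.SS $(q.cop.scop_mul_twist (q.S h)))
    rw [SS_mul, SS_mul, SS_cop_scop, SS_cop_comul] at this
    rw [this, show q.cop.S (q.S h) = h from q.Sinv_S h]
  refine q.eq_twist _ hg ?_
  have := congr(q.SS $(q.cop.twist_mul_comul_alpha))
  rwa [SS_mul, SS_cop_comul, hg, SS_cop_aEl, show q.S q.cop.alpha = q.alpha from q.S_Sinv _]
    at this

theorem sum_eq_VL :
    ∑ a ∈ Finset.range q.np, ∑ c ∈ Finset.range q.np, ∑ m ∈ Finset.range (q.n (q.pL1 c)),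
      (q.qR1 a * q.d1 (q.pL1 c) m) ⊗ₜ[k] (q.Sinv (q.pL2 c) * q.qR2 a * q.d2 (q.pL1 c) m)
      = q.sswapInv (q.twist * q.pRE) := by
  let τ := Algebra.TensorProduct.comm k H H
  have hpR1 : q.cop.pR1 = q.pL2 := rfl
  have hpR2 : q.cop.pR2 = q.pL1 := by
    ext a; simp [pR2, pL1, cop, q.Sinv_mul, mul_assoc]
  have hqL1 : q.cop.qL1 = q.qR2 := by
    ext a; simp [qL1, qR2, cop, q.Sinv_mul]
  have hqL2 : q.cop.qL2 = q.qR1 := rfl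
  have hpL1 : q.cop.pL1 = q.pR2 := by
    ext a; simp [pR2, pL1, cop, q.S_mul, q.S_Sinv, mul_assoc]
  have hpL2 : q.cop.pL2 = q.pR1 := rfl
  have hτ (x : H ⊗[k] H) : q.sswapInv (q.SS x) = τ x := by
    induction x using TensorProduct.induction_on with
    | zero => simp
    | add x x' h h' => simp only [map_add, h, h']
    | tmul a b => simp [q.Sinv_S, τ]
  have hp : τ (q.cop.sswap q.cop.pLE) = q.sswapInv q.pRE := by
    simp only [pLE, pRE, hpL1, hpL2, map_sum, sswap_tmul, sswapInv_tmul]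
    rfl
  have h := congr(τ $(q.cop.sum_eq_VR'.trans q.cop.VR'_eq))
  rw [hpR1, hpR2, hqL1, hqL2, map_mul, hp, ← hτ q.cop.twist, SS_cop_twist, ← sswapInv_mul] at h
  rw [← h, Finset.sum_comm]
  simp only [map_sum]
  rfl

open MulOpposite

/-- `a ⊗ b ↦ b ⊗ a`, into the tensor square of the opposite algebra -/
def opRev₂ : H ⊗[k] H →ₗ[k] Hᵐᵒᵖ ⊗[k] Hᵐᵒᵖ := lin₂ fun a b => op b ⊗ₜ op a

/-- `a ⊗ b ⊗ c ↦ c ⊗ b ⊗ a`, into the tensor cube of the opposite algebra -/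
def opRev₃ : H ⊗[k] (H ⊗[k] H) →ₗ[k] Hᵐᵒᵖ ⊗[k] (Hᵐᵒᵖ ⊗[k] Hᵐᵒᵖ) :=
  lin₃ fun a b c => op c ⊗ₜ (op b ⊗ₜ op a)

/-- `a ⊗ b ⊗ c ⊗ d ↦ d ⊗ c ⊗ b ⊗ a`, into the tensor power of the opposite algebra -/
def opRev₄ : H ⊗[k] (H ⊗[k] (H ⊗[k] H)) →ₗ[k]
    Hᵐᵒᵖ ⊗[k] (Hᵐᵒᵖ ⊗[k] (Hᵐᵒᵖ ⊗[k] Hᵐᵒᵖ)) :=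
  lin₄ fun a b c d => op d ⊗ₜ (op c ⊗ₜ (op b ⊗ₜ op a))

@[simp]
theorem opRev₂_tmul (a b : H) : opRev₂ (a ⊗ₜ[k] b) = op b ⊗ₜ op a := rfl

@[simp]
theorem opRev₃_tmul (a b c : H) :
    opRev₃ (a ⊗ₜ[k] (b ⊗ₜ[k] c)) = op c ⊗ₜ (op b ⊗ₜ op a) := rfl

@[simp]
theorem opRev₄_tmul (a b c d : H) :
    opRev₄ (a ⊗ₜ[k] (b ⊗ₜ[k] (c ⊗ₜ[k] d))) = op d ⊗ₜ (op c ⊗ₜ (op b ⊗ₜ op a)) := rfl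

theorem opRev₂_mul (x y : H ⊗[k] H) : opRev₂ (x * y) = opRev₂ y * opRev₂ x := by
  induction x using TensorProduct.induction_on with
  | zero => simp
  | add x x' h h' => simp only [add_mul, mul_add, map_add, h, h']
  | tmul a b =>
    induction y using TensorProduct.induction_on with
    | zero => simp
    | add y y' h h' => simp only [add_mul, mul_add, map_add, h, h']
    | tmul c d => simp

theorem opRev₃_mul (x y : H ⊗[k] (H ⊗[k] H)) : opRev₃ (x * y) = opRev₃ y * opRev₃ x := by
  induction x using tensor_induction₃ with
  | add x x' h h' => simp only [add_mul, mul_add, map_add, h, h']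
  | pure a b c =>
    induction y using tensor_induction₃ with
    | add y y' h h' => simp only [add_mul, mul_add, map_add, h, h']
    | pure a' b' c' => simp

theorem opRev₄_mul (x y : H ⊗[k] (H ⊗[k] (H ⊗[k] H))) :
    opRev₄ (x * y) = opRev₄ y * opRev₄ x := by
  induction x using tensor_induction₄ with
  | add x x' h h' => simp only [add_mul, mul_add, map_add, h, h']
  | pure a b c d =>
    induction y using tensor_induction₄ with
    | add y y' h h' => simp only [add_mul, mul_add, map_add, h, h']
    | pure a' b' c' d' => simp

theorem opRev₂_one : opRev₂ (1 : H ⊗[k] H) = 1 := rfl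

theorem opRev₃_one : opRev₃ (1 : H ⊗[k] (H ⊗[k] H)) = 1 := rfl

/-- The comultiplication of the opposite and coopposite quasi-Hopf algebra. -/
def opcopComul : Hᵐᵒᵖ →ₐ[k] Hᵐᵒᵖ ⊗[k] Hᵐᵒᵖ :=
  AlgHom.ofLinearMap (opRev₂ ∘ₗ q.comul.toLinearMap ∘ₗ (opLinearEquiv k).symm.toLinearMap)
    (by
      change opRev₂ (q.comul 1) = 1
      rw [map_one, opRev₂_one])
    (fun x y => by
      change opRev₂ (q.comul (y.unop * x.unop)) = _
      rw [map_mul, opRev₂_mul]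
      rfl)

/-- The counit of the opposite algebra. -/
def opCounit : Hᵐᵒᵖ →ₐ[k] k :=
  AlgHom.ofLinearMap (q.counit.toLinearMap ∘ₗ (opLinearEquiv k).symm.toLinearMap)
    (map_one q.counit) (fun x y => (map_mul q.counit y.unop x.unop).trans (mul_comm _ _))

@[simp]
theorem opcopComul_apply (x : Hᵐᵒᵖ) : q.opcopComul x = opRev₂ (q.comul x.unop) := rfl

@[simp]
theorem opCounit_apply (x : Hᵐᵒᵖ) : q.opCounit x = q.counit x.unop := rfl

/-- The opposite and coopposite quasi-Hopf algebra. -/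
def opcop : QuasiHopf k Hᵐᵒᵖ where
  comul := q.opcopComul
  counit := q.opCounit
  n h := q.n h.unop
  d1 h i := op (q.d2 h.unop i)
  d2 h i := op (q.d1 h.unop i)
  comul_eq h := by simp [q.comul_eq h.unop]
  np := q.np
  P1 i := op (q.P3 i)
  P2 i := op (q.P2 i)
  P3 i := op (q.P1 i)
  nq := q.nq
  Q1 i := op (q.Q3 i)
  Q2 i := op (q.Q2 i)
  Q3 i := op (q.Q1 i)
  S := (opLinearEquiv k).toLinearMap ∘ₗ q.S ∘ₗ (opLinearEquiv k).symm.toLinearMap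
  Sinv := (opLinearEquiv k).toLinearMap ∘ₗ q.Sinv ∘ₗ (opLinearEquiv k).symm.toLinearMap
  alpha := op q.beta
  beta := op q.alpha
  S_one := by simp [q.S_one]
  S_mul := by simp [q.S_mul]
  Sinv_S := by simp [q.Sinv_S]
  S_Sinv := by simp [q.S_Sinv]
  phi_phiInv := by
    have h := congr(opRev₃ $(q.PhiInv_mul_Phi))
    simpa only [Phi, PhiInv, opRev₃_mul, map_sum, opRev₃_tmul, opRev₃_one] using h
  phiInv_phi := by
    have h := congr(opRev₃ $(q.Phi_mul_PhiInv))
    simpa only [Phi, PhiInv, opRev₃_mul, map_sum, opRev₃_tmul, opRev₃_one] using h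
  qcoassoc h := by
    have hC : q.C1 h.unop = q.PhiInv * q.C2 h.unop * q.Phi := by
      rw [PhiInv_mul_C2, mul_assoc, PhiInv_mul_Phi, mul_one]
    have h := congr(opRev₃ $hC)
    simpa [C1, C2, Phi, PhiInv, q.comul_eq, sum_tmul, tmul_sum, opRev₃_mul, mul_assoc] using h
  counit_left h := by
    simpa using congr(op $(q.counit_right h.unop))
  counit_right h := by
    simpa using congr(op $(q.counit_left h.unop))
  pentagon := by
    have h := congr(opRev₄ $(q.pentagon_Phi))
    simpa [Phi, D1_tmul, D2_tmul, D3_tmul, I4_tmul, I1_apply, q.comul_eq, tmul_sum,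
      opRev₄_mul, mul_assoc] using h
  counit_mid_phi := by
    have h := congr(opRev₂ $(q.e2_Phi))
    simpa [Phi, opRev₂_one, Algebra.TensorProduct.one_def] using h
  antipode_alpha h := by
    simpa [mul_assoc] using congr(op $(q.antipode_beta h.unop))
  antipode_beta h := by
    simpa [mul_assoc] using congr(op $(q.antipode_alpha h.unop))
  nondeg_1 := by
    simpa [mul_assoc] using congr(op $(q.nondeg_1))
  nondeg_2 := by
    simpa [mul_assoc] using congr(op $(q.nondeg_2))
  counit_alpha := by simp [q.counit_beta]
  counit_beta := by simp [q.counit_alpha]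

/-- `a ⊗ b ↦ b ⊗ a`, from the tensor square of the opposite algebra -/
def unopRev₂ : Hᵐᵒᵖ ⊗[k] Hᵐᵒᵖ →ₗ[k] H ⊗[k] H := lin₂ fun a b => unop b ⊗ₜ unop a

@[simp]
theorem unopRev₂_tmul (a b : Hᵐᵒᵖ) : unopRev₂ (a ⊗ₜ[k] b) = unop b ⊗ₜ unop a := rfl

theorem unopRev₂_mul (x y : Hᵐᵒᵖ ⊗[k] Hᵐᵒᵖ) :
    unopRev₂ (x * y) = unopRev₂ y * unopRev₂ x := by
  induction x using TensorProduct.induction_on with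
  | zero => simp
  | add x x' h h' => simp only [add_mul, mul_add, map_add, h, h']
  | tmul a b =>
    induction y using TensorProduct.induction_on with
    | zero => simp
    | add y y' h h' => simp only [add_mul, mul_add, map_add, h, h']
    | tmul c d => simp

theorem unopRev₂_opRev₂ (x : H ⊗[k] H) : unopRev₂ (opRev₂ x) = x := by
  induction x using TensorProduct.induction_on with
  | zero => simp
  | add x x' h h' => simp only [map_add, h, h']
  | tmul a b => rfl

theorem opcop_S_op (x : H) : q.opcop.S (op x) = op (q.S x) := rfl

theorem opcop_Sinv_op (x : H) : q.opcop.Sinv (op x) = op (q.Sinv x) := rfl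

theorem opcop_pR1 (b : ℕ) : q.opcop.pR1 b = op (q.qL2 b) := rfl

theorem opcop_pR2 (b : ℕ) : q.opcop.pR2 b = op (q.qL1 b) := by
  simp [pR2, qL1, opcop, mul_assoc]

theorem opcop_qL1 (b : ℕ) : q.opcop.qL1 b = op (q.pR2 b) := by
  simp [pR2, qL1, opcop, mul_assoc]

theorem opcop_qL2 (b : ℕ) : q.opcop.qL2 b = op (q.pR1 b) := rfl

theorem opcop_pL1 (a : ℕ) : q.opcop.pL1 a = op (q.qR2 a) := by
  simp [pL1, qR2, opcop]

theorem opcop_pL2 (a : ℕ) : q.opcop.pL2 a = op (q.qR1 a) := rfl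

theorem opcop_qR1 (a : ℕ) : q.opcop.qR1 a = op (q.pL2 a) := rfl

theorem opcop_qR2 (a : ℕ) : q.opcop.qR2 a = op (q.pL1 a) := by
  simp [pL1, qR2, opcop]

theorem unopRev₂_opcop_comul (x : H) : unopRev₂ (q.opcop.comul (op x)) = q.comul x :=
  unopRev₂_opRev₂ _

theorem unopRev₂_opcop_scop (x : H) : unopRev₂ (q.opcop.scop (op x)) = q.scop x := by
  simp [scop, opcop]

theorem unopRev₂_opcop_aEl : unopRev₂ q.opcop.aEl = q.bEl := by
  simp [aEl, bEl, opcop, mul_assoc]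

theorem unopRev₂_opcop_twist : unopRev₂ q.opcop.twist = q.twistInv := by
  simp only [twist, twistInv, map_sum, unopRev₂_mul, opcop_pR1, opcop_pR2, unopRev₂_opcop_comul,
    unopRev₂_opcop_scop, unopRev₂_opcop_aEl, mul_assoc]
  rfl

theorem unopRev₂_opcop_sswapInv (x : Hᵐᵒᵖ ⊗[k] Hᵐᵒᵖ) :
    unopRev₂ (q.opcop.sswapInv x) = q.sswapInv (unopRev₂ x) := by
  induction x using TensorProduct.induction_on with
  | zero => simp
  | add x x' h h' => simp only [map_add, h, h']
  | tmul a b => rfl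

theorem sum_eq_UL :
    ∑ c ∈ Finset.range q.nq, ∑ b ∈ Finset.range q.nq, ∑ m ∈ Finset.range (q.n (q.qL1 c)),
      (q.d1 (q.qL1 c) m * q.pR1 b) ⊗ₜ[k] (q.d2 (q.qL1 c) m * q.pR2 b * q.S (q.qL2 c))
      = q.twistInv * q.sswap q.qRE := by
  have hp : unopRev₂ (q.opcop.sswap q.opcop.pLE) = q.sswap q.qRE := by
    simp only [pLE, qRE, map_sum, sswap_tmul, opcop_pL1, opcop_pL2]
    rfl
  have h := congr(unopRev₂ $(q.opcop.sum_eq_VR'.trans q.opcop.VR'_eq))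
  rw [unopRev₂_mul, hp, unopRev₂_opcop_twist] at h
  rw [← h]
  simp only [map_sum, unopRev₂_tmul, opcop_pR1, opcop_pR2, opcop_qL1, opcop_qL2, opcop_S_op,
    unop_mul, mul_assoc]
  rfl

theorem sum_eq_UR :
    ∑ a ∈ Finset.range q.np, ∑ c ∈ Finset.range q.np, ∑ m ∈ Finset.range (q.n (q.qR2 a)),
      (q.d1 (q.qR2 a) m * q.pL1 c * q.Sinv (q.qR1 a)) ⊗ₜ[k] (q.d2 (q.qR2 a) m * q.pL2 c)
      = q.sswapInv (q.qLE * q.twistInv) := by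
  have hp : unopRev₂ q.opcop.pRE = q.qLE := by
    simp only [pRE, qLE, map_sum, opcop_pR1, opcop_pR2]
    rfl
  have h := congr(unopRev₂ $(q.opcop.sum_eq_VL))
  rw [unopRev₂_opcop_sswapInv, unopRev₂_mul, hp, unopRev₂_opcop_twist, Finset.sum_comm] at h
  rw [← h]
  simp only [map_sum, unopRev₂_tmul, opcop_pL1, opcop_pL2, opcop_qR1, opcop_qR2, opcop_Sinv_op,
    unop_mul, mul_assoc]
  rfl

end QuasiHopf

/-- The four identities of Lemma 3.3 (relating `p^R, q^R, p^L, q^L`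
and the Drinfeld twist `f`) hold in `H ⊗ H`. -/
theorem statement2 (k H : Type) [Field k] [Ring H] [Algebra k H] (q : QuasiHopf k H) :
    -- (1)  S(p^R_1) q^L_1 p^R_2(1) ⊗ q^L_2 p^R_2(2) = S(p^L_2) f1 ⊗ S(p^L_1) f2
    (∑ b ∈ Finset.range q.nq, ∑ c ∈ Finset.range q.nq, ∑ m ∈ Finset.range (q.n (q.pR2 b)),
        (q.S (q.pR1 b) * q.qL1 c * q.d1 (q.pR2 b) m) ⊗ₜ[k] (q.qL2 c * q.d2 (q.pR2 b) m)
      = q.sswap q.pLE * q.twist) ∧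
    -- (2)  q^R_2(1) p^L_1 S̄(q^R_1) ⊗ q^R_2(2) p^L_2 = S̄(q^L_2 f̄2) ⊗ S̄(q^L_1 f̄1)
    (∑ a ∈ Finset.range q.np, ∑ c ∈ Finset.range q.np, ∑ m ∈ Finset.range (q.n (q.qR2 a)),
        (q.d1 (q.qR2 a) m * q.pL1 c * q.Sinv (q.qR1 a)) ⊗ₜ[k] (q.d2 (q.qR2 a) m * q.pL2 c)
      = q.sswapInv (q.qLE * q.twistInv)) ∧
    -- (3)  q^R_1 p^L_1(1) ⊗ S̄(p^L_2) q^R_2 p^L_1(2) = S̄(f2 p^R_2) ⊗ S̄(f1 p^R_1)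
    (∑ a ∈ Finset.range q.np, ∑ c ∈ Finset.range q.np, ∑ m ∈ Finset.range (q.n (q.pL1 c)),
        (q.qR1 a * q.d1 (q.pL1 c) m) ⊗ₜ[k] (q.Sinv (q.pL2 c) * q.qR2 a * q.d2 (q.pL1 c) m)
      = q.sswapInv (q.twist * q.pRE)) ∧
    -- (4)  q^L_1(1) p^R_1 ⊗ q^L_1(2) p^R_2 S(q^L_2) = f̄1 S(q^R_2) ⊗ f̄2 S(q^R_1)
    (∑ c ∈ Finset.range q.nq, ∑ b ∈ Finset.range q.nq, ∑ m ∈ Finset.range (q.n (q.qL1 c)),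
        (q.d1 (q.qL1 c) m * q.pR1 b) ⊗ₜ[k] (q.d2 (q.qL1 c) m * q.pR2 b * q.S (q.qL2 c))
      = q.twistInv * q.sswap q.qRE) := by
  exact ⟨q.sum_eq_VR'.trans q.VR'_eq, q.sum_eq_UR, q.sum_eq_VL, q.sum_eq_UL⟩
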